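/- Let B = ⊕_{n≥0} B_n be a finitely generated graded ℂ-algebra which is an integral domain with B_0 = ℂ, generated in a single degree e by elements f₀ t^e, …, f_r t^e where f_i are nonzero elements of a field extension of ℂ (and t is transcendental). Then the Krull dimension of B equals trdeg_ℂ ℂ(f₁/f₀, …, f_r/f₀) + 1. In particular, if trdeg_ℂ ℂ(f₁/f₀, …, f_r/f₀) ≤ a, then dim B ≤ a + 1. -/

import Mathlib

noncomputable section

/-- the transcendence degree of an F-algebra E, as an extended natural number:
the supremum of cardinalities of finite algebraically independent families. -/
def trdeg (F E : Type*) [CommRing F] [CommRing E] [Algebra F E] : ℕ∞ :=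
  sSup {n : ℕ∞ | ∃ m : ℕ, (n = (m : ℕ∞)) ∧ ∃ y : Fin m → E, AlgebraicIndependent F y}

theorem aux_dim_integral {R S : Type*} [CommRing R] [CommRing S] [Algebra R S]
    [Algebra.IsIntegral R S] [FaithfulSMul R S] : ringKrullDim S = ringKrullDim R := by
  apply le_antisymm
  · refine Order.krullDim_le_of_strictMono (PrimeSpectrum.comap (algebraMap R S)) ?_
    intro a b hab
    exact Ideal.IsIntegral.comap_lt_comap (R := R) (I := a.asIdeal) (J := b.asIdeal) hab
  · refine iSup_le fun l => ?_
    obtain ⟨Q, hQ1, hQ2⟩ := (Ideal.nonempty_primesOver (S := S) (RelSeries.head l).asIdeal).some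
    obtain ⟨L, hL, -⟩ := Ideal.exists_ltSeries_of_hasGoingUp (S := S) l Q
    rw [← hL]
    exact Order.LTSeries.length_le_krullDim L

theorem aux_dim {k R : Type} [Field k] [CommRing R] [IsDomain R] [Algebra k R]
    [Algebra.FiniteType k R] :
    ∃ s : ℕ, ringKrullDim R = (s : ℕ∞) ∧ Algebra.trdeg k R = s := by
  obtain ⟨s, g, hg, hi⟩ := exists_integral_inj_algHom_of_fg k R
  refine ⟨s, ?_, ?_⟩
  · algebraize [g.toRingHom]
    have : FaithfulSMul (MvPolynomial (Fin s) k) R :=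
      (faithfulSMul_iff_algebraMap_injective _ _).mpr hg
    have : Algebra.IsIntegral (MvPolynomial (Fin s) k) R := ⟨hi⟩
    rw [aux_dim_integral (R := MvPolynomial (Fin s) k),
      MvPolynomial.ringKrullDim_of_isNoetherianRing]
    simp
  · algebraize [g.toRingHom]
    have : FaithfulSMul (MvPolynomial (Fin s) k) R :=
      (faithfulSMul_iff_algebraMap_injective _ _).mpr hg
    have : Algebra.IsIntegral (MvPolynomial (Fin s) k) R := ⟨hi⟩
    rw [← _root_.trdeg_add_eq k (MvPolynomial (Fin s) k) (A := R),
      _root_.trdeg_eq_zero (R := MvPolynomial (Fin s) k)]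
    simp

theorem aux_trdeg {k E : Type} [Field k] [Field E] [Algebra k E] (m : ℕ)
    (h : Algebra.trdeg k E = m) : trdeg k E = m := by
  apply le_antisymm
  · refine sSup_le ?_
    rintro _ ⟨n, rfl, y, hy⟩
    have := hy.cardinalMk_le_trdeg
    rw [h] at this
    simpa using this
  · refine le_sSup ⟨m, rfl, ?_⟩
    obtain ⟨s, hs⟩ := exists_isTranscendenceBasis k E
    have h1 := hs.cardinalMk_eq_trdeg
    rw [h, ← Cardinal.mk_fin, Cardinal.eq] at h1
    obtain ⟨φ⟩ := h1
    exact ⟨fun i => φ.symm i, hs.1.comp _ φ.symm.injective⟩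

open Polynomial in
theorem aux_alg {K : Type} [Field K] [Algebra ℂ K] {r : ℕ} (c : Fin (r + 1) → K)
    (c' : Fin (r + 1) → IntermediateField.adjoin ℂ (Set.range c))
    (hc' : ∀ i, (c' i : K) = c i) (h0 : c 0 = 1) :
    Algebra.trdeg ℂ (Algebra.adjoin ℂ (Set.range fun i => (C (c' i) * X : 
      (IntermediateField.adjoin ℂ (Set.range c))[X]))) =
    Algebra.trdeg ℂ (IntermediateField.adjoin ℂ (Set.range c)) + 1 := by
  let E := IntermediateField.adjoin ℂ (Set.range c)
  change Fin (r + 1) → E at c'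
  let B := Algebra.adjoin ℂ (Set.range fun i => (C (c' i) * X : E[X]))
  have hgen : ∀ i, IsAlgebraic B (C (c' i) * X : E[X]) := fun i =>
    isAlgebraic_algebraMap (⟨_, Algebra.subset_adjoin ⟨i, rfl⟩⟩ : B)
  have h0' : c' 0 = 1 := Subtype.ext (by rw [hc', h0]; rfl)
  have hX : IsAlgebraic B (X : E[X]) := by simpa [h0'] using hgen 0
  have hXn : (X : E[X]) ∈ nonZeroDivisors E[X] := mem_nonZeroDivisors_of_ne_zero X_ne_zero
  have hci : ∀ i, IsAlgebraic B (C (c' i) : E[X]) := fun i => by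
    have := hgen i
    rw [mul_comm] at this
    exact IsAlgebraic.of_mul hXn hX this
  have hC : ∀ (x : K) (hx : x ∈ E), IsAlgebraic B (C (⟨x, hx⟩ : E) : E[X]) := by
    intro x hx
    induction hx using IntermediateField.adjoin_induction with
    | mem x hx =>
      obtain ⟨i, rfl⟩ := hx
      convert hci i
      exact (hc' i).symm
    | algebraMap x =>
      exact isAlgebraic_algebraMap (algebraMap ℂ B x)
    | add x y hx hy h1 h2 =>
      have h3 := h1.add h2
      rw [← C_add] at h3; exact h3
    | mul x y hx hy h1 h2 =>
      have h3 := h1.mul h2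
      rw [← C_mul] at h3; exact h3
    | inv x hx h1 =>
      by_cases h : x = 0
      · subst h
        convert isAlgebraic_zero (R := B) (A := E[X])
        rw [C_eq_zero]
        exact Subtype.ext inv_zero
      · refine IsAlgebraic.of_mul (mem_nonZeroDivisors_of_ne_zero ?_) h1 (z := _) ?_
        · rw [Ne, C_eq_zero]
          exact fun h' => h (congrArg Subtype.val h')
        · have h3 : IsAlgebraic B (1 : E[X]) := isAlgebraic_one
          rw [← C_1] at h3
          rw [← C_mul]
          have h4 : (⟨x, hx⟩ : E) * ⟨x⁻¹, E.inv_mem hx⟩ = 1 := Subtype.ext (mul_inv_cancel₀ h)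
          rw [← h4] at h3
          exact h3
  have hall : Algebra.IsAlgebraic B E[X] := by
    constructor
    intro p
    induction p using Polynomial.induction_on' with
    | add p q hp hq => exact hp.add hq
    | monomial n a =>
      rw [← C_mul_X_pow_eq_monomial]
      exact (hC a.1 a.2).mul (hX.pow n)
  have : FaithfulSMul ℂ B :=
    (faithfulSMul_iff_algebraMap_injective _ _).mpr (algebraMap ℂ B).injective
  have h1 := _root_.trdeg_add_eq ℂ B (A := E[X])
  have h2 := _root_.trdeg_add_eq ℂ E (A := E[X])
  rw [_root_.trdeg_eq_zero (R := B), add_zero] at h1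
  rw [h1, ← h2, Polynomial.trdeg_of_isDomain]

open Polynomial in
theorem aux_equiv {K : Type} [Field K] [Algebra ℂ K] (E : IntermediateField ℂ K) {r : ℕ}
    (f : Fin (r + 1) → K) (hf : f 0 ≠ 0) (e : ℕ) (he : 0 < e) (c' : Fin (r + 1) → E)
    (hc' : ∀ i, (c' i : K) = f i / f 0) :
    Nonempty (Algebra.adjoin ℂ (Set.range fun i => (C (c' i) * X : E[X])) ≃ₐ[ℂ]
      Algebra.adjoin ℂ (Set.range fun i => (C (f i) * X ^ e : K[X]))) := by
  let φ : E[X] →ₐ[ℂ] K[X] :=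
    ((Polynomial.aeval (C (f 0) * X ^ e : K[X])).restrictScalars ℂ :  K[X] →ₐ[ℂ] K[X]).comp
      (Polynomial.mapAlgHom E.val)
  have hφ : Function.Injective φ := by
    refine Function.Injective.comp (g := Polynomial.aeval (R := K) (C (f 0) * X ^ e : K[X])) ?_
      (Polynomial.map_injective (E.val : E →+* K) E.val.injective)
    have : Transcendental K (C (f 0) * X ^ e : K[X]) := by
      refine Polynomial.transcendental _ ?_ ?_
      · rw [natDegree_C_mul_X_pow _ _ hf]; exact he.ne'
      · simp [hf]
    exact transcendental_iff_injective.mp this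
  have him : Algebra.adjoin ℂ (Set.range fun i => (C (f i) * X ^ e : K[X])) =
      (Algebra.adjoin ℂ (Set.range fun i => (C (c' i) * X : E[X]))).map φ := by
    rw [AlgHom.map_adjoin, ← Set.range_comp]
    congr 2
    funext i
    simp [φ, hc']
    rw [← mul_assoc, ← C_mul, div_mul_cancel₀ _ hf]
  rw [him]
  exact ⟨Subalgebra.equivMapOfInjective _ φ hφ⟩

open Polynomial in
/-- Let B = ℂ[f₀tᵉ,…,f_r tᵉ] ⊆ K[t], where the fᵢ are nonzero elements of a field extension K
of ℂ. Then the Krull dimension of B is trdeg_ℂ ℂ(f₁/f₀,…,f_r/f₀) + 1; in particular if this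
transcendence degree is at most a then dim B ≤ a + 1. -/
theorem krullDim_of_single_degree_generated (K : Type) [Field K] [Algebra ℂ K]
    (r : ℕ) (f : Fin (r + 1) → K) (hf : ∀ i, f i ≠ 0) (e : ℕ) (he : 0 < e) :
    ringKrullDim (Algebra.adjoin ℂ
        (Set.range fun i : Fin (r + 1) => (C (f i) * X ^ e : Polynomial K)))
      = (((trdeg ℂ (IntermediateField.adjoin ℂ
          (Set.range fun i : Fin (r + 1) => f i / f 0) : IntermediateField ℂ K) + 1 : ℕ∞)) :
          WithBot ℕ∞) ∧
    ∀ a : ℕ, trdeg ℂ (IntermediateField.adjoin ℂ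
          (Set.range fun i : Fin (r + 1) => f i / f 0) : IntermediateField ℂ K) ≤ (a : ℕ∞) →
      ringKrullDim (Algebra.adjoin ℂ
          (Set.range fun i : Fin (r + 1) => (C (f i) * X ^ e : Polynomial K)))
        ≤ (((a : ℕ∞) + 1 : ℕ∞) : WithBot ℕ∞) := by
  have key : ringKrullDim (Algebra.adjoin ℂ
        (Set.range fun i : Fin (r + 1) => (C (f i) * X ^ e : Polynomial K)))
      = (((trdeg ℂ (IntermediateField.adjoin ℂ
          (Set.range fun i : Fin (r + 1) => f i / f 0) : IntermediateField ℂ K) + 1 : ℕ∞)) :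
          WithBot ℕ∞) := by
    have : Algebra.FiniteType ℂ (Algebra.adjoin ℂ
        (Set.range fun i : Fin (r + 1) => (C (f i) * X ^ e : Polynomial K))) :=
      (Subalgebra.fg_iff_finiteType _).mp (Subalgebra.fg_def.mpr ⟨_, Set.finite_range _, rfl⟩)
    obtain ⟨s, hs1, hs2⟩ := aux_dim (k := ℂ) (R := Algebra.adjoin ℂ
        (Set.range fun i : Fin (r + 1) => (C (f i) * X ^ e : Polynomial K)))
    let c' : Fin (r + 1) → IntermediateField.adjoin ℂ
          (Set.range fun i : Fin (r + 1) => f i / f 0) := fun i =>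
      ⟨f i / f 0, IntermediateField.subset_adjoin _ _ ⟨i, rfl⟩⟩
    obtain ⟨ψ⟩ := aux_equiv _ f (hf 0) e he c' (fun _ => rfl)
    have h1 := aux_alg (fun i => f i / f 0) c' (fun _ => rfl) (div_self (hf 0))
    rw [ψ.trdeg_eq, hs2] at h1
    have hlt : Algebra.trdeg ℂ (IntermediateField.adjoin ℂ
          (Set.range fun i : Fin (r + 1) => f i / f 0)) < Cardinal.aleph0 := by
      refine lt_of_le_of_lt ?_ (Cardinal.natCast_lt_aleph0 (n := s))
      rw [h1]
      exact self_le_add_right _ _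
    obtain ⟨m, hm⟩ := Cardinal.lt_aleph0.mp hlt
    rw [aux_trdeg m hm, hs1]
    rw [hm] at h1
    have h2 : s = m + 1 := by exact_mod_cast h1
    subst h2
    rfl
  refine ⟨key, fun a ha => ?_⟩
  rw [key]
  exact WithBot.coe_le_coe.mpr (add_le_add_left ha 1)
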